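/- arXiv:1301.3330 — 4 statements merged into one kernel-verified Lean document; each statement's English description precedes it below -/
import Mathlib

section
/- Let V be a finite-dimensional real vector space, let B be an alternating bilinear form on V and A a linear functional on V. Then the linear map e(B,A) : W → W defined by e(B,A)(X,ξ,λ) = (X, ξ + B(X,·) − 2λA − A(X)·A, λ + A(X)) preserves the bilinear form: ⟨e(B,A)u, e(B,A)v⟩ = ⟨u,v⟩ for all u,v in W. -/
open Module LinearMap

/-- The `Bₙ`-generalized tangent space of `V`: `W = V × V* × ℝ`. -/
abbrev GenW (V : Type*) [AddCommGroup V] [Module ℝ V] :=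
  V × Module.Dual ℝ V × ℝ

/-- The symmetric pairing `⟨(X,ξ,λ),(Y,η,μ)⟩ = (1/2)(ξ(Y) + η(X)) + λμ`. -/
noncomputable def genPair {V : Type*} [AddCommGroup V] [Module ℝ V]
    (u v : GenW V) : ℝ :=
  (1 / 2 : ℝ) * (u.2.1 v.1 + v.2.1 u.1) + u.2.2 * v.2.2

/-- The action of a `(B+A)`-field on `W = V × V* × ℝ`:
`e(B,A)(X,ξ,λ) = (X, ξ + B(X,·) − 2λA − A(X)·A, λ + A(X))`. -/
noncomputable def eBA {V : Type*} [AddCommGroup V] [Module ℝ V]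
    (B : LinearMap.BilinForm ℝ V) (A : Module.Dual ℝ V) (u : GenW V) : GenW V :=
  (u.1, u.2.1 + B u.1 - (2 * u.2.2) • A - (A u.1) • A, u.2.2 + A u.1)

/-- `e(B,A)` preserves the bilinear form on `V × V* × ℝ`:
`⟨e(B,A)u, e(B,A)v⟩ = ⟨u,v⟩` for every alternating `2`-form `B` and `1`-form `A`. -/
theorem eBA_isometry {V : Type*} [AddCommGroup V] [Module ℝ V] [FiniteDimensional ℝ V]
    (B : LinearMap.BilinForm ℝ V) (hB : B.IsAlt) (A : Module.Dual ℝ V)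
    (u v : GenW V) :
    genPair (eBA B A u) (eBA B A v) = genPair u v := by
  have hB' : B v.1 u.1 = -B u.1 v.1 := (hB.neg_eq u.1 v.1).symm
  simp only [genPair, eBA, LinearMap.sub_apply, LinearMap.add_apply, LinearMap.smul_apply,
    smul_eq_mul, hB']
  ring
end

section
/- Let V be a finite-dimensional real vector space. For alternating 2-forms B, B' on V and linear functionals A, A' on V, the transformations e(B,A)(X,ξ,λ) = (X, ξ + B(X,·) − 2λA − A(X)·A, λ + A(X)) satisfy the composition law e(B,A) ∘ e(B',A') = e(B + B' + A∧A', A + A'), where A∧A' is the alternating 2-form (X,Y) ↦ A(X)A'(Y) − A(Y)A'(X). -/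
open Module LinearMap

/-- The wedge product of two `1`-forms, as the alternating bilinear form
`(A∧A')(X,Y) = A(X)A'(Y) − A(Y)A'(X)`. -/
noncomputable def wedge11 {V : Type*} [AddCommGroup V] [Module ℝ V]
    (A A' : Module.Dual ℝ V) : LinearMap.BilinForm ℝ V :=
  A.smulRight A' - A'.smulRight A

/-- Composition law of `(B+A)`-fields:
`e(B,A) ∘ e(B',A') = e(B + B' + A∧A', A + A')`. -/
theorem eBA_comp {V : Type*} [AddCommGroup V] [Module ℝ V] [FiniteDimensional ℝ V]
    (B B' : LinearMap.BilinForm ℝ V) (hB : B.IsAlt) (hB' : B'.IsAlt)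
    (A A' : Module.Dual ℝ V) :
    (eBA B A) ∘ (eBA B' A') = eBA (B + B' + wedge11 A A') (A + A') := by
  funext ⟨X, ξ, l⟩
  refine Prod.ext rfl (Prod.ext ?_ ?_)
  · ext Y
    simp [eBA, wedge11]
    ring
  · simp [eBA]
    ring
end

section
/- Let V be a 3-dimensional real vector space. For every generalized vector u = (X,ξ,λ) ∈ V × V* × ℝ and every element φ = φ₀ + φ₁ + φ₂ + φ₃ of the exterior algebra Λ(V*), the Clifford action u·φ = ι_Xφ + ξ∧φ + λτφ is isotropic with respect to the Chevalley pairing: ⟨u·φ, φ⟩ = 0 in Λ³(V*). -/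
set_option synthInstance.maxHeartbeats 1000000
set_option maxHeartbeats 1000000

open Module ExteriorAlgebra

variable {V : Type*} [AddCommGroup V] [Module ℝ V]

/-- Projection onto the degree-`k` component of the exterior algebra `Λ(V*)`. -/
noncomputable def gproj (V : Type*) [AddCommGroup V] [Module ℝ V] (k : ℕ) :
    ExteriorAlgebra ℝ (Module.Dual ℝ V) →ₗ[ℝ] ExteriorAlgebra ℝ (Module.Dual ℝ V) :=
  GradedAlgebra.proj (fun i : ℕ => ⋀[ℝ]^i (Module.Dual ℝ V)) k

/-- The Chevalley pairing on `Λ(V*)` for a `3`-dimensional space `V`: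
`⟨φ,ψ⟩ = φ₀ψ₃ + ψ₀φ₃ − φ₁∧ψ₂ − ψ₁∧φ₂` (a `Λ³(V*)`-valued symmetric form, written
inside the exterior algebra). -/
noncomputable def chevPair (φ ψ : ExteriorAlgebra ℝ (Module.Dual ℝ V)) :
    ExteriorAlgebra ℝ (Module.Dual ℝ V) :=
  gproj V 0 φ * gproj V 3 ψ + gproj V 0 ψ * gproj V 3 φ
    - gproj V 1 φ * gproj V 2 ψ - gproj V 1 ψ * gproj V 2 φ

/-- The Clifford action of a generalized vector `(X,ξ,λ) ∈ V × V* × ℝ` on `Λ(V*)`: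
`(X,ξ,λ)·φ = ι_Xφ + ξ∧φ + λτφ`. -/
noncomputable def cliffAct (X : V) (ξ : Module.Dual ℝ V) (l : ℝ)
    (φ : ExteriorAlgebra ℝ (Module.Dual ℝ V)) : ExteriorAlgebra ℝ (Module.Dual ℝ V) :=
  CliffordAlgebra.contractLeft (Module.Dual.eval ℝ V X) φ
    + ExteriorAlgebra.ι ℝ ξ * φ
    + l • CliffordAlgebra.involute φ

lemma gproj_mem (k : ℕ) (x : ExteriorAlgebra ℝ (Module.Dual ℝ V)) :
    gproj V k x ∈ ⋀[ℝ]^k (Module.Dual ℝ V) :=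
  SetLike.coe_mem (DirectSum.decompose (fun i : ℕ => ⋀[ℝ]^i (Module.Dual ℝ V)) x k)

lemma exists_algebraMap_eq_gproj_zero (x : ExteriorAlgebra ℝ (Module.Dual ℝ V)) :
    ∃ r : ℝ, algebraMap ℝ (ExteriorAlgebra ℝ (Module.Dual ℝ V)) r = gproj V 0 x := by
  have h := gproj_mem 0 x
  rw [exteriorPower, pow_zero] at h
  exact Submodule.mem_one.mp h

lemma exists_ι_eq_gproj_one (x : ExteriorAlgebra ℝ (Module.Dual ℝ V)) :
    ∃ a : Module.Dual ℝ V, ExteriorAlgebra.ι ℝ a = gproj V 1 x := by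
  have h := gproj_mem 1 x
  rw [exteriorPower, pow_one] at h
  exact h

lemma ι_mem_exteriorPower_one (a : Module.Dual ℝ V) :
    ExteriorAlgebra.ι ℝ a ∈ ⋀[ℝ]^1 (Module.Dual ℝ V) := by
  rw [exteriorPower, pow_one]
  exact LinearMap.mem_range_self _ a

lemma gproj_succ_ι_mul (k : ℕ) (a : Module.Dual ℝ V)
    (x : ExteriorAlgebra ℝ (Module.Dual ℝ V)) :
    gproj V (k + 1) (ExteriorAlgebra.ι ℝ a * x) = ExteriorAlgebra.ι ℝ a * gproj V k x := by
  rw [add_comm]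
  exact DirectSum.coe_decompose_mul_add_of_left_mem
    (fun i : ℕ => ⋀[ℝ]^i (Module.Dual ℝ V)) (ι_mem_exteriorPower_one a)

lemma gproj_zero_ι_mul (a : Module.Dual ℝ V) (x : ExteriorAlgebra ℝ (Module.Dual ℝ V)) :
    gproj V 0 (ExteriorAlgebra.ι ℝ a * x) = 0 :=
  DirectSum.coe_decompose_mul_of_left_mem_of_not_le
    (fun i : ℕ => ⋀[ℝ]^i (Module.Dual ℝ V)) (ι_mem_exteriorPower_one a) (by norm_num)

lemma gproj_zero_algebraMap (r : ℝ) :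
    gproj V 0 (algebraMap ℝ _ r) = algebraMap ℝ _ r :=
  DirectSum.decompose_of_mem_same (fun i : ℕ => ⋀[ℝ]^i (Module.Dual ℝ V))
    (SetLike.algebraMap_mem_graded _ r)

lemma gproj_succ_algebraMap (k : ℕ) (r : ℝ) :
    gproj V (k + 1) (algebraMap ℝ _ r) = 0 :=
  DirectSum.decompose_of_mem_ne (fun i : ℕ => ⋀[ℝ]^i (Module.Dual ℝ V))
    (SetLike.algebraMap_mem_graded _ r) (Nat.succ_ne_zero k).symm

lemma contractLeft_gproj_zero (d : Module.Dual ℝ (Module.Dual ℝ V))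
    (x : ExteriorAlgebra ℝ (Module.Dual ℝ V)) :
    CliffordAlgebra.contractLeft d (gproj V 0 x) = 0 := by
  obtain ⟨r, hr⟩ := exists_algebraMap_eq_gproj_zero x
  rw [← hr]
  exact CliffordAlgebra.contractLeft_algebraMap _ d r

/-- Contraction lowers the degree by one. -/
lemma gproj_contractLeft (d : Module.Dual ℝ (Module.Dual ℝ V)) (k : ℕ)
    (x : ExteriorAlgebra ℝ (Module.Dual ℝ V)) :
    gproj V k (CliffordAlgebra.contractLeft d x)
      = CliffordAlgebra.contractLeft d (gproj V (k + 1) x) := by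
  induction x using CliffordAlgebra.left_induction generalizing k with
  | algebraMap r =>
    rw [CliffordAlgebra.contractLeft_algebraMap, map_zero]
    exact ((congrArg _ (gproj_succ_algebraMap k r)).trans (map_zero _)).symm
  | add x y hx hy => simp only [map_add, hx, hy]
  | ι_mul x a hx =>
    change gproj V k (CliffordAlgebra.contractLeft d (CliffordAlgebra.ι 0 a * x)) =
      CliffordAlgebra.contractLeft d (gproj V (k + 1) (ExteriorAlgebra.ι ℝ a * x))
    rw [gproj_succ_ι_mul, ExteriorAlgebra.ι, CliffordAlgebra.contractLeft_ι_mul,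
      CliffordAlgebra.contractLeft_ι_mul, map_sub, map_smul]
    congr 1
    cases k with
    | zero =>
      rw [contractLeft_gproj_zero, mul_zero]
      exact gproj_zero_ι_mul a _
    | succ k =>
      rw [← hx k]
      exact gproj_succ_ι_mul k a _

lemma gproj_involute (k : ℕ) (x : ExteriorAlgebra ℝ (Module.Dual ℝ V)) :
    gproj V k (CliffordAlgebra.involute x) = (-1 : ℝ) ^ k • gproj V k x := by
  induction x using CliffordAlgebra.left_induction generalizing k with
  | algebraMap r =>
    rw [AlgHom.commutes]
    cases k with
    | zero => simp
    | succ k =>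
      have h := gproj_succ_algebraMap (V := V) k r
      exact h.trans ((congrArg _ h).trans (smul_zero _)).symm
  | add x y hx hy => simp only [map_add, hx, hy, smul_add]
  | ι_mul x a hx =>
    rw [map_mul, CliffordAlgebra.involute_ι, neg_mul, map_neg]
    cases k with
    | zero =>
      have h := gproj_zero_ι_mul a x
      have h' := gproj_zero_ι_mul a (CliffordAlgebra.involute x)
      rw [ExteriorAlgebra.ι] at h h'
      rw [h, h', neg_zero, smul_zero]
    | succ k =>
      have h := gproj_succ_ι_mul k a x
      have h' := gproj_succ_ι_mul k a (CliffordAlgebra.involute x)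
      rw [ExteriorAlgebra.ι] at h h'
      rw [h, h', hx, pow_succ, mul_smul_comm, mul_neg_one, neg_smul]

lemma involute_gproj (k : ℕ) (x : ExteriorAlgebra ℝ (Module.Dual ℝ V)) :
    CliffordAlgebra.involute (gproj V k x) = (-1 : ℝ) ^ k • gproj V k x := by
  induction x using CliffordAlgebra.left_induction generalizing k with
  | algebraMap r =>
    cases k with
    | zero =>
      have h := gproj_zero_algebraMap (V := V) r
      rw [pow_zero, one_smul]
      exact (congrArg _ h).trans ((AlgHom.commutes _ r).trans h.symm)
    | succ k =>
      have h := gproj_succ_algebraMap (V := V) k r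
      exact ((congrArg _ h).trans (map_zero _)).trans ((congrArg _ h).trans (smul_zero _)).symm
  | add x y hx hy => simp only [map_add, hx, hy, smul_add]
  | ι_mul x a hx =>
    cases k with
    | zero =>
      have h := gproj_zero_ι_mul a x
      rw [ExteriorAlgebra.ι] at h
      rw [h, map_zero, smul_zero]
    | succ k =>
      have h := gproj_succ_ι_mul k a x
      rw [ExteriorAlgebra.ι] at h
      rw [h, map_mul, hx, CliffordAlgebra.involute_ι, pow_succ, neg_mul, mul_smul_comm,
        mul_neg_one, neg_smul]

/-- Graded commutativity of the exterior algebra, for a factor of degree one. -/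
lemma ι_mul_eq_involute_mul_ι (a : Module.Dual ℝ V)
    (x : ExteriorAlgebra ℝ (Module.Dual ℝ V)) :
    ExteriorAlgebra.ι ℝ a * x = CliffordAlgebra.involute x * ExteriorAlgebra.ι ℝ a := by
  induction x using CliffordAlgebra.left_induction with
  | algebraMap r =>
    rw [AlgHom.commutes]
    exact (Algebra.commutes r _).symm
  | add x y hx hy => rw [mul_add, hx, hy, map_add, add_mul]
  | ι_mul x b hx =>
    have h := ExteriorAlgebra.ι_add_mul_swap (R := ℝ) a b
    rw [map_mul, CliffordAlgebra.involute_ι, mul_assoc, ← hx, ← mul_assoc, ← mul_assoc, neg_mul]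
    rw [← ExteriorAlgebra.ι, eq_neg_of_add_eq_zero_left h]

/-- Contraction is a graded derivation. -/
lemma contractLeft_mul_eq (d : Module.Dual ℝ (Module.Dual ℝ V))
    (x y : ExteriorAlgebra ℝ (Module.Dual ℝ V)) :
    CliffordAlgebra.contractLeft d (x * y) = CliffordAlgebra.contractLeft d x * y
      + CliffordAlgebra.involute x * CliffordAlgebra.contractLeft d y := by
  induction x using CliffordAlgebra.left_induction with
  | algebraMap r =>
    rw [CliffordAlgebra.contractLeft_algebraMap_mul, CliffordAlgebra.contractLeft_algebraMap,
      AlgHom.commutes, zero_mul, zero_add]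
  | add x z hx hz => rw [add_mul, map_add, hx, hz, map_add, map_add, add_mul, add_mul]; abel
  | ι_mul x a hx =>
    rw [mul_assoc, CliffordAlgebra.contractLeft_ι_mul, CliffordAlgebra.contractLeft_ι_mul, hx,
      map_mul, CliffordAlgebra.involute_ι]
    simp only [mul_add, sub_mul, neg_mul, mul_assoc, smul_mul_assoc]
    abel

lemma eq_zero_of_mem_exteriorPower_four [FiniteDimensional ℝ V]
    (h3 : Module.finrank ℝ V = 3) {x : ExteriorAlgebra ℝ (Module.Dual ℝ V)}
    (hx : x ∈ ⋀[ℝ]^4 (Module.Dual ℝ V)) : x = 0 := by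
  have h : Module.finrank ℝ (⋀[ℝ]^4 (Module.Dual ℝ V)) = 0 := by
    rw [exteriorPower.finrank_eq, Subspace.dual_finrank_eq, h3]
    rfl
  rw [Submodule.finrank_eq_zero] at h
  rwa [h, Submodule.mem_bot] at hx

/-- On a `3`-dimensional space, the Clifford action is isotropic for the Chevalley
pairing: `⟨u·φ, φ⟩ = 0` for every generalized vector `u = (X,ξ,λ)` and spinor `φ`. -/
theorem chevPair_cliffAct_self [FiniteDimensional ℝ V] (h3 : Module.finrank ℝ V = 3)
    (X : V) (ξ : Module.Dual ℝ V) (l : ℝ)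
    (φ : ExteriorAlgebra ℝ (Module.Dual ℝ V)) :
    chevPair (cliffAct X ξ l φ) φ = 0 := by
  have hX4 : CliffordAlgebra.contractLeft (Module.Dual.eval ℝ V X) (gproj V 4 φ) = 0 := by
    rw [eq_zero_of_mem_exteriorPower_four h3 (gproj_mem 4 φ), map_zero]
  have h13 : CliffordAlgebra.contractLeft (Module.Dual.eval ℝ V X) (gproj V 1 φ) * gproj V 3 φ
      = gproj V 1 φ * CliffordAlgebra.contractLeft (Module.Dual.eval ℝ V X) (gproj V 3 φ) := by
    have h := contractLeft_mul_eq (Module.Dual.eval ℝ V X) (gproj V 1 φ) (gproj V 3 φ)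
    rw [eq_zero_of_mem_exteriorPower_four h3
      (SetLike.mul_mem_graded (gproj_mem 1 φ) (gproj_mem 3 φ)), map_zero, involute_gproj,
      pow_one, neg_one_smul, neg_mul, ← sub_eq_add_neg] at h
    exact sub_eq_zero.mp h.symm
  have h22 : CliffordAlgebra.contractLeft (Module.Dual.eval ℝ V X) (gproj V 2 φ) * gproj V 2 φ
      = 0 := by
    have h := contractLeft_mul_eq (Module.Dual.eval ℝ V X) (gproj V 2 φ) (gproj V 2 φ)
    obtain ⟨b, hb⟩ := exists_ι_eq_gproj_one
      (CliffordAlgebra.contractLeft (Module.Dual.eval ℝ V X) φ)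
    rw [gproj_contractLeft] at hb
    rw [eq_zero_of_mem_exteriorPower_four h3
      (SetLike.mul_mem_graded (gproj_mem 2 φ) (gproj_mem 2 φ)), map_zero, ← hb,
      ← ι_mul_eq_involute_mul_ι] at h
    rw [← hb]
    rw [← two_smul ℝ] at h
    exact (smul_eq_zero.mp h.symm).resolve_left two_ne_zero
  have h01 : gproj V 0 φ * (ExteriorAlgebra.ι ℝ ξ * gproj V 2 φ)
      = ExteriorAlgebra.ι ℝ ξ * gproj V 0 φ * gproj V 2 φ := by
    obtain ⟨r, hr⟩ := exists_algebraMap_eq_gproj_zero φ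
    rw [← hr, ← mul_assoc, Algebra.commutes]
  have h11 : gproj V 1 φ * (ExteriorAlgebra.ι ℝ ξ * gproj V 1 φ) = 0 := by
    obtain ⟨a, ha⟩ := exists_ι_eq_gproj_one φ
    rw [← ha, eq_neg_of_add_eq_zero_left (ExteriorAlgebra.ι_add_mul_swap ξ a), mul_neg,
      ← mul_assoc, ExteriorAlgebra.ι_sq_zero, zero_mul, neg_zero]
  simp only [chevPair, cliffAct, map_add, map_smul, gproj_contractLeft, gproj_involute,
    gproj_zero_ι_mul, gproj_succ_ι_mul 0, gproj_succ_ι_mul 1,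
    gproj_succ_ι_mul 2, Nat.reduceAdd, zero_add, hX4, add_mul, mul_add, h13, h22, h01, h11,
    smul_mul_assoc, mul_smul_comm, zero_mul]
  module
end

section
/- Let V be a finite-dimensional real vector space and W = V × V* × ℝ with bilinear form ⟨(X,ξ,λ),(Y,η,μ)⟩ = (1/2)(ξ(Y) + η(X)) + λμ. A linear endomorphism F of W is skew-adjoint with respect to this form (⟨Fu,v⟩ + ⟨u,Fv⟩ = 0 for all u,v) if and only if there exist E ∈ End(V), a skew map β : V* → V (i.e., η(β(ξ)) = −ξ(β(η)) for all ξ,η ∈ V*), an alternating 2-form B on V, a vector α ∈ V and a 1-form A ∈ V* such that F(X,ξ,λ) = (E(X) + β(ξ) − 2λα, B(X,·) − ξ∘E − 2λA, A(X) + ξ(α)). -/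
open Module LinearMap

/-- A linear endomorphism `F` of `W = V × V* × ℝ` is skew-adjoint for the canonical
bilinear form iff, for some `E ∈ End(V)`, a skew map `β : V* → V`, an alternating
`2`-form `B`, a vector `α ∈ V` and a `1`-form `A ∈ V*`,
`F(X,ξ,λ) = (E(X) + β(ξ) − 2λα, B(X,·) − ξ∘E − 2λA, A(X) + ξ(α))`. -/
theorem skew_adjoint_iff_block_form {V : Type*} [AddCommGroup V] [Module ℝ V]
    [FiniteDimensional ℝ V] (F : GenW V →ₗ[ℝ] GenW V) :
    (∀ u v : GenW V, genPair (F u) v + genPair u (F v) = 0) ↔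
    ∃ (E : V →ₗ[ℝ] V) (β : Module.Dual ℝ V →ₗ[ℝ] V),
      (∀ ξ η : Module.Dual ℝ V, η (β ξ) = - ξ (β η)) ∧
      ∃ (B : LinearMap.BilinForm ℝ V), B.IsAlt ∧
      ∃ (α : V) (A : Module.Dual ℝ V),
        ∀ (X : V) (ξ : Module.Dual ℝ V) (l : ℝ),
          F (X, ξ, l)
            = (E X + β ξ - (2 * l) • α, B X - ξ ∘ₗ E - (2 * l) • A, A X + ξ α) := by
  constructor
  · intro h
    have fst_eq (X : V) (ξ : Module.Dual ℝ V) (l : ℝ) :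
        (F (X, ξ, l)).1 = (F (X, 0, 0)).1 + (F (0, ξ, 0)).1 + l • (F (0, 0, 1)).1 := by
      have hsplit : ((X, ξ, l) : GenW V) = (X, 0, 0) + (0, ξ, 0) + l • (0, 0, 1) := by simp
      rw [hsplit, map_add, map_add, map_smul]
      rfl
    have form_skew (X Y : V) : (F (X, 0, 0)).2.1 Y = -(F (Y, 0, 0)).2.1 X := by
      have := h (X, 0, 0) (Y, 0, 0)
      simp [genPair] at this
      linarith
    have form_eq (X : V) (ξ : Module.Dual ℝ V) (l : ℝ) (Y : V) :
        (F (X, ξ, l)).2.1 Y =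
          (F (X, 0, 0)).2.1 Y - ξ (F (Y, 0, 0)).1 - 2 * l * (F (Y, 0, 0)).2.2 := by
      have := h (X, ξ, l) (Y, 0, 0)
      simp [genPair] at this
      linarith [form_skew X Y]
    have scalar_eq (X : V) (ξ : Module.Dual ℝ V) (l : ℝ) :
        (F (X, ξ, l)).2.2 = (F (X, 0, 0)).2.2 - (1 / 2) * ξ (F (0, 0, 1)).1 := by
      have hu := h (X, ξ, l) (0, 0, 1)
      have hX := h (X, 0, 0) (0, 0, 1)
      have h1 := h (0, 0, 1) (0, 0, 1)
      simp [genPair] at hu hX h1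
      simp only [h1, mul_zero, add_zero] at hu
      linarith
    refine ⟨LinearMap.fst ℝ _ _ ∘ₗ F ∘ₗ LinearMap.inl ℝ _ _,
      LinearMap.fst ℝ _ _ ∘ₗ F ∘ₗ LinearMap.inr ℝ _ _ ∘ₗ LinearMap.inl ℝ _ _, ?_,
      LinearMap.fst ℝ _ _ ∘ₗ LinearMap.snd ℝ _ _ ∘ₗ F ∘ₗ LinearMap.inl ℝ _ _, ?_,
      (-(1 / 2) : ℝ) • (F (0, 0, 1)).1,
      LinearMap.snd ℝ _ _ ∘ₗ LinearMap.snd ℝ _ _ ∘ₗ F ∘ₗ LinearMap.inl ℝ _ _, ?_⟩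
    · intro ξ η
      have := h (0, ξ, 0) (0, η, 0)
      simp [genPair] at this
      change η (F (0, ξ, 0)).1 = -ξ (F (0, η, 0)).1
      linarith
    · intro X
      change (F (X, 0, 0)).2.1 X = 0
      linarith [form_skew X X]
    · intro X ξ l
      refine Prod.ext ?_ (Prod.ext (LinearMap.ext fun Y => ?_) ?_)
      · rw [fst_eq]
        change _ = (F (X, 0, 0)).1 + (F (0, ξ, 0)).1
          - (2 * l) • ((-(1 / 2) : ℝ) • (F (0, 0, 1)).1)
        module
      · exact form_eq X ξ l Y
      · rw [scalar_eq]
        change _ = (F (X, 0, 0)).2.2 + ξ ((-(1 / 2) : ℝ) • (F (0, 0, 1)).1)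
        rw [map_smul, smul_eq_mul]
        ring
  · rintro ⟨E, β, hβ, B, hB, α, A, hF⟩ ⟨X, ξ, l⟩ ⟨Y, η, m⟩
    rw [hF, hF]
    simp only [genPair, LinearMap.sub_apply, LinearMap.smul_apply, LinearMap.comp_apply,
      map_add, map_sub, map_smul, smul_eq_mul]
    linear_combination (1 / 2) * hβ ξ η - (1 / 2) * LinearMap.IsAlt.neg hB X Y
end
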